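/- arXiv:2503.17958 — 3 statements merged into one kernel-verified Lean document; each statement's English description precedes it below -/
import Mathlib

section
/- Let X and Y be locally compact Hausdorff spaces, p : X → Y a proper continuous map, and μ a positive Radon measure on X. Let A be a dense ℂ-subalgebra of C₀(Y) and let M be a ℂ-linear subspace of C₀(X) consisting of μ-integrable functions, such that (a ∘ p)·m ∈ M for every a ∈ A, m ∈ M, and satisfying: (1) M is stable under pointwise complex conjugation; (2) for every y ∈ Y the set of restrictions of elements of M to p⁻¹(y) is dense in C(p⁻¹(y)) with the sup norm; (3) for every m ∈ M there exists a real-valued n ∈ M with |m(x)| ≤ n(x) for all x ∈ X. Then for every μ-Riemann integrable function φ : X → ℂ and every ε > 0 there exist m₁, m₂ ∈ M with m₂ real-valued, |φ(x) − m₁(x)| ≤ m₂(x) for all x ∈ X, and ∫ m₂ dμ < ε. -/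
open scoped ZeroAtInfty
open MeasureTheory

open scoped Topology

/-- In a locally compact Hausdorff space, a compact set admits a finite continuous partition of
unity subordinate to a given choice of neighbourhoods, and supported in a given compact
neighbourhood. -/
lemma exists_finite_partition {Z : Type*} [TopologicalSpace Z] [T2Space Z]
    [LocallyCompactSpace Z] {L K : Set Z} (hL : IsCompact L) (hLK : L ⊆ interior K)
    (W : Z → Set Z) (hW : ∀ z ∈ L, W z ∈ 𝓝 z) :
    ∃ (t : Finset Z) (χ : t → C(Z, ℝ)), (∀ i, HasCompactSupport (χ i)) ∧
      (∀ i z, 0 ≤ χ i z) ∧ (∀ i z, χ i z ≠ 0 → z ∈ W i ∧ z ∈ K) ∧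
      (∀ z, ∑ i, χ i z ≤ 1) ∧ ∀ z ∈ L, ∑ i, χ i z = 1 := by
  obtain ⟨t, -, ht⟩ := hL.elim_nhds_subcover (fun z => interior (W z) ∩ interior K)
    (fun z hz => Filter.inter_mem (interior_mem_nhds.2 (hW z hz))
      (isOpen_interior.mem_nhds (hLK hz)))
  obtain ⟨χ, hsub, hcs⟩ := PartitionOfUnity.exists_isSubordinate_of_locallyFinite_t2space hL
    (fun i : t => interior (W i) ∩ interior K)
    (fun i => isOpen_interior.inter isOpen_interior) (locallyFinite_of_finite _)
    (fun z hz => by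
      obtain ⟨i, hi, hz⟩ := Set.mem_iUnion₂.1 (ht hz)
      exact Set.mem_iUnion.2 ⟨⟨i, hi⟩, hz⟩)
  refine ⟨t, χ, hcs, fun i z => χ.nonneg i z, fun i z hz => ?_, fun z => ?_, fun z hz => ?_⟩
  · have := hsub i (subset_tsupport _ hz)
    exact ⟨interior_subset this.1, interior_subset this.2⟩
  · rw [← finsum_eq_sum_of_fintype]
    exact χ.sum_le_one z
  · rw [← finsum_eq_sum_of_fintype]
    exact χ.sum_eq_one hz

lemma norm_sub_weighted_sum_le {ι : Type*} [Fintype ι] {w c : ι → ℝ} {v : ℂ} {g : ι → ℂ}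
    (hw : ∀ i, 0 ≤ w i) (hv : v ≠ 0 → ∑ i, w i = 1) (hg : ∀ i, w i ≠ 0 → ‖v - g i‖ ≤ c i) :
    ‖v - ∑ i, (w i : ℂ) * g i‖ ≤ ∑ i, w i * c i := by
  have h : v - ∑ i, (w i : ℂ) * g i = ∑ i, (w i : ℂ) * (v - g i) := by
    simp only [mul_sub, Finset.sum_sub_distrib, ← Finset.sum_mul]
    by_cases h0 : v = 0
    · simp [h0]
    · rw [← Complex.ofReal_sum, hv h0]
      simp
  rw [h]
  refine (norm_sum_le _ _).trans (Finset.sum_le_sum fun i _ => ?_)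
  rw [norm_mul, Complex.norm_real, Real.norm_of_nonneg (hw i)]
  by_cases h0 : w i = 0
  · simp [h0]
  · exact mul_le_mul_of_nonneg_left (hg i h0) (hw i)

lemma zeroAtInfty_sum_apply {X ι : Type*} [TopologicalSpace X] (s : Finset ι)
    (f : ι → C₀(X, ℂ)) (x : X) : (∑ i ∈ s, f i) x = ∑ i ∈ s, f i x := by
  classical
  induction s using Finset.induction_on with
  | empty => simp
  | insert i s hi ih => simp [Finset.sum_insert hi, ih]

lemma zeroAtInfty_norm_apply_sub_le {X : Type*} [TopologicalSpace X] (f g : C₀(X, ℂ)) (x : X) :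
    ‖f x - g x‖ ≤ dist f g := by
  rw [← ZeroAtInftyContinuousMap.dist_toBCF_eq_dist, ← dist_eq_norm]
  exact BoundedContinuousFunction.dist_coe_le_dist (f := f.toBCF) (g := g.toBCF) x

/-- A dense subset of `C₀(Y, ℂ)` approximates compactly supported real functions uniformly. -/
lemma exists_mem_norm_sub_lt_of_dense {Y : Type*} [TopologicalSpace Y] {A : Set C₀(Y, ℂ)}
    (hA : Dense A) (χ : C(Y, ℝ)) (hχ : HasCompactSupport χ) {η : ℝ} (hη : 0 < η) :
    ∃ a ∈ A, ∀ y, ‖(χ y : ℂ) - a y‖ ≤ η := by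
  let f : C₀(Y, ℂ) :=
    { toFun := fun y => (χ y : ℂ)
      continuous_toFun := by fun_prop
      zero_at_infty' := by
        have : HasCompactSupport (fun y => (χ y : ℂ)) := hχ.comp_left Complex.ofReal_zero
        exact this.is_zero_at_infty }
  obtain ⟨a, ha, hd⟩ := hA.exists_dist_lt f hη
  exact ⟨a, ha, fun y => (zeroAtInfty_norm_apply_sub_le f a y).trans hd.le⟩

lemma exists_mem_eq_re {X : Type*} [TopologicalSpace X] {M : Submodule ℂ C₀(X, ℂ)}
    (hconj : ∀ m ∈ M, ∃ m' ∈ M, ∀ x, m' x = (starRingEnd ℂ) (m x)) {m : C₀(X, ℂ)} (hm : m ∈ M) :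
    ∃ r ∈ M, ∀ x, r x = ((m x).re : ℂ) := by
  obtain ⟨m', hm', h⟩ := hconj m hm
  refine ⟨(1 / 2 : ℂ) • (m + m'), M.smul_mem _ (M.add_mem hm hm'), fun x => ?_⟩
  simp only [ZeroAtInftyContinuousMap.smul_apply, ZeroAtInftyContinuousMap.add_apply, h,
    Complex.add_conj, smul_eq_mul]
  push_cast
  ring

section Approximation

variable {X Y : Type*} [TopologicalSpace X] [TopologicalSpace Y]

/-- A space of functions approximating `1` on every fiber of a closed map contains, for each
compact `K`, a nonnegative function which is at least `1` above `K`. -/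
lemma exists_mem_one_le_on_preimage {p : X → Y} (hcl : IsClosedMap p)
    (M : Submodule ℂ C₀(X, ℂ))
    (hdense : ∀ y : Y, ∀ g : C(↥(p ⁻¹' ({y} : Set Y)), ℂ), ∀ ε > 0,
      ∃ m ∈ M, ∀ x : ↥(p ⁻¹' ({y} : Set Y)), ‖g x - m (x : X)‖ < ε)
    (hdom : ∀ m ∈ M, ∃ n ∈ M, (∀ x, (n x).im = 0) ∧ ∀ x, ‖m x‖ ≤ (n x).re)
    {K : Set Y} (hK : IsCompact K) :
    ∃ n ∈ M, (∀ x, (n x).im = 0) ∧ (∀ x, 0 ≤ (n x).re) ∧ ∀ x, p x ∈ K → 1 ≤ (n x).re := by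
  refine hK.induction_on (p := fun K => ∃ n ∈ M, (∀ x, (n x).im = 0) ∧ (∀ x, 0 ≤ (n x).re) ∧
    ∀ x, p x ∈ K → 1 ≤ (n x).re) ?_ (fun s t hst ih => ?_) (fun s t ihs iht => ?_)
    fun y _ => ?_
  · exact ⟨0, M.zero_mem, by simp, by simp, by simp⟩
  · obtain ⟨n, hn, h1, h2, h3⟩ := ih
    exact ⟨n, hn, h1, h2, fun x hx => h3 x (hst hx)⟩
  · obtain ⟨n, hn, h1, h2, h3⟩ := ihs
    obtain ⟨n', hn', h1', h2', h3'⟩ := iht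
    refine ⟨n + n', M.add_mem hn hn', fun x => by simp [h1, h1'],
      fun x => by simpa using add_nonneg (h2 x) (h2' x), fun x hx => ?_⟩
    have := h2 x
    have := h2' x
    simp only [ZeroAtInftyContinuousMap.add_apply, Complex.add_re]
    rcases hx with hx | hx
    · linarith [h3 x hx]
    · linarith [h3' x hx]
  · obtain ⟨m, hm, h⟩ := hdense y 1 (1 / 2) (by norm_num)
    obtain ⟨n, hn, h1, h2⟩ := hdom m hm
    have hev : ∀ᶠ y' in 𝓝 y, ∀ x ∈ p ⁻¹' {y'}, 1 / 2 < ‖m x‖ := by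
      refine hcl.eventually_nhds_fiber (p := fun x => 1 / 2 < ‖m x‖) y fun x hx => ?_
      refine (continuous_const.continuousAt (x := x)).eventually_lt
        (map_continuous m).norm.continuousAt ?_
      have h3 := h ⟨x, hx⟩
      have h4 := norm_sub_norm_le (1 : ℂ) (m x)
      simp only [ContinuousMap.one_apply] at h3
      rw [norm_one] at h4
      linarith
    refine ⟨_, mem_nhdsWithin_of_mem_nhds hev, (2 : ℂ) • n, M.smul_mem _ hn, fun x => ?_,
      fun x => ?_, fun x hx => ?_⟩
    · simp [h1]
    · have := (norm_nonneg _).trans (h2 x)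
      simpa using this
    · have h3 := hx x rfl
      have h4 := h2 x
      have : 1 ≤ 2 * (n x).re := by linarith
      simpa using this

/-- Continuous compactly supported functions can be approximated by elements of `M` up to an error
dominated by an element of `M` with small integral. -/
lemma exists_mem_norm_sub_le_of_hasCompactSupport [T2Space Y] [LocallyCompactSpace Y]
    [MeasurableSpace X] {p : X → Y} (hp : Continuous p) (hcl : IsClosedMap p)
    (μ : Measure X) {A : Set C₀(Y, ℂ)} (hA : Dense A) (M : Submodule ℂ C₀(X, ℂ))
    (hint : ∀ m ∈ M, Integrable (fun x => m x) μ)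
    (hmod : ∀ a ∈ A, ∀ m ∈ M, ∃ m' ∈ M, ∀ x, m' x = a (p x) * m x)
    (hdense : ∀ y : Y, ∀ g : C(↥(p ⁻¹' ({y} : Set Y)), ℂ), ∀ ε > 0,
      ∃ m ∈ M, ∀ x : ↥(p ⁻¹' ({y} : Set Y)), ‖g x - m (x : X)‖ < ε)
    (hdom : ∀ m ∈ M, ∃ n ∈ M, (∀ x, (n x).im = 0) ∧ ∀ x, ‖m x‖ ≤ (n x).re)
    {f : X → ℂ} (hf : Continuous f) (hfc : HasCompactSupport f) {ε : ℝ} (hε : 0 < ε) :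
    ∃ m ∈ M, ∃ n ∈ M, (∀ x, (n x).im = 0) ∧ (∀ x, ‖f x - m x‖ ≤ (n x).re) ∧
      ∫ x, (n x).re ∂μ < ε := by
  have hL : IsCompact (p '' tsupport f) := hfc.isCompact.image hp
  obtain ⟨K, hK, hLK⟩ := exists_compact_superset hL
  obtain ⟨n₀, hn₀, him₀, hnn₀, hone₀⟩ := exists_mem_one_le_on_preimage hcl M hdense hdom hK
  obtain ⟨δ, hδ, hδε⟩ := exists_pos_mul_lt (half_pos hε) (∫ x, (n₀ x).re ∂μ)
  choose m hmM hm using fun y : Y =>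
    hdense y ⟨fun x => f x, hf.comp continuous_subtype_val⟩ δ hδ
  choose n hnM him hn using fun y : Y => hdom (m y) (hmM y)
  obtain ⟨t, χ, hcs, hχ0, hχW, hχ1, hχL⟩ := exists_finite_partition hL hLK
    (fun y => {y' | ∀ x ∈ p ⁻¹' {y'}, ‖f x - m y x‖ < δ}) (fun y _ =>
      hcl.eventually_nhds_fiber (p := fun x => ‖f x - m y x‖ < δ) y fun x hx =>
        (hf.sub (map_continuous (m y))).norm.continuousAt.eventually_lt
          continuous_const.continuousAt (hm y ⟨x, hx⟩))
  have hNM : ∑ i : t, n i ∈ M := M.sum_mem fun i _ => hnM i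
  obtain ⟨η, hη, hηε⟩ := exists_pos_mul_lt (half_pos hε) (∫ x, ((∑ i : t, n i) x).re ∂μ)
  choose a haA ha using fun i : t => exists_mem_norm_sub_lt_of_dense hA (χ i) (hcs i) hη
  choose m' hm'M hm' using fun i : t => hmod (a i) (haA i) (m i) (hmM i)
  have hre : ∀ x, ((((δ : ℂ) • n₀ + (η : ℂ) • ∑ i : t, n i : C₀(X, ℂ))) x).re
      = (n₀ x).re * δ + ((∑ i : t, n i) x).re * η := fun x => by
    simp [mul_comm]
  refine ⟨∑ i, m' i, M.sum_mem fun i _ => hm'M i, (δ : ℂ) • n₀ + (η : ℂ) • ∑ i : t, n i,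
    M.add_mem (M.smul_mem _ hn₀) (M.smul_mem _ hNM), fun x => ?_, fun x => ?_, ?_⟩
  · simp [him₀, him, zeroAtInfty_sum_apply]
  · rw [hre]
    have h1 : ‖f x - ∑ i, (χ i (p x) : ℂ) * m i x‖ ≤ ∑ i, χ i (p x) * δ :=
      norm_sub_weighted_sum_le (fun i => hχ0 i _)
        (fun h => hχL _ ⟨x, subset_tsupport _ h, rfl⟩)
        (fun i hi => ((hχW i _ hi).1 x rfl).le)
    have h2 : ∑ i, χ i (p x) * δ ≤ (n₀ x).re * δ := by
      rw [← Finset.sum_mul]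
      refine mul_le_mul_of_nonneg_right ?_ hδ.le
      by_cases hx : p x ∈ K
      · exact (hχ1 _).trans (hone₀ x hx)
      · rw [Finset.sum_eq_zero fun i _ => by_contra fun h => hx (hχW i _ h).2]
        exact hnn₀ x
    have h3 : ‖∑ i, (χ i (p x) : ℂ) * m i x - ∑ i, m' i x‖ ≤ ((∑ i : t, n i) x).re * η := by
      rw [← Finset.sum_sub_distrib, zeroAtInfty_sum_apply, Complex.re_sum, Finset.sum_mul]
      refine (norm_sum_le _ _).trans (Finset.sum_le_sum fun i _ => ?_)
      rw [hm', ← sub_mul, norm_mul, mul_comm]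
      exact mul_le_mul (hn i x) (ha i _) (norm_nonneg _) ((norm_nonneg _).trans (hn i x))
    rw [zeroAtInfty_sum_apply]
    have h4 := norm_sub_le_norm_sub_add_norm_sub (f x) (∑ i, (χ i (p x) : ℂ) * m i x)
      (∑ i, m' i x)
    linarith
  · simp only [hre]
    have hi : Integrable (fun x => (n₀ x).re * δ) μ := (hint _ hn₀).re.mul_const δ
    have hi' : Integrable (fun x => ((∑ i : t, n i) x).re * η) μ := (hint _ hNM).re.mul_const η
    rw [integral_add hi hi',
      integral_mul_const, integral_mul_const]
    linarith

/-- A bounded, compactly supported, almost everywhere continuous function lies within a continuous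
compactly supported function of small integral of a continuous compactly supported function. -/
lemma exists_hasCompactSupport_norm_sub_le [T2Space X] [LocallyCompactSpace X]
    [MeasurableSpace X] [BorelSpace X] (μ : Measure X) [μ.Regular] {φ : X → ℂ}
    (hbdd : ∃ C : ℝ, ∀ x, ‖φ x‖ ≤ C) (hsupp : HasCompactSupport φ)
    (hnull : μ {x | ¬ ContinuousAt φ x} = 0) {ε : ℝ} (hε : 0 < ε) :
    ∃ (g : X → ℂ) (u : X → ℝ), Continuous g ∧ HasCompactSupport g ∧ Continuous u ∧
      HasCompactSupport u ∧ (∀ x, ‖φ x - g x‖ ≤ u x) ∧ ∫ x, u x ∂μ < ε := by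
  classical
  obtain ⟨C, hC⟩ := hbdd
  obtain ⟨K, hK, hLK⟩ := exists_compact_superset hsupp.isCompact
  obtain ⟨δ, hδ, hδε⟩ := exists_pos_mul_lt (half_pos hε) (μ.real K)
  obtain ⟨η, hη, hηε⟩ := exists_pos_mul_lt (half_pos hε) (2 * |C|)
  obtain ⟨U, hDU, hUo, hU⟩ := Set.exists_isOpen_lt_of_lt {x | ¬ ContinuousAt φ x}
    (ENNReal.ofReal η) (by rw [hnull]; exact ENNReal.ofReal_pos.2 hη)
  have hUfin : μ U ≠ ⊤ := hU.ne_top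
  have hUη : μ.real U ≤ η := ENNReal.toReal_le_of_le_ofReal hη.le hU.le
  obtain ⟨t, χ, hcs, hχ0, hχW, hχ1, hχL⟩ := exists_finite_partition hsupp.isCompact hLK
    (fun x => if x ∈ U then U else {z | ‖φ z - φ x‖ < δ}) (fun x _ => by
      by_cases hx : x ∈ U
      · simpa [hx] using hUo.mem_nhds hx
      · have hcont : ContinuousAt φ x := by_contra fun h => hx (hDU h)
        simp only [hx, if_false]
        filter_upwards [Metric.tendsto_nhds.1 hcont δ hδ] with z hz
        simpa [dist_eq_norm] using hz)
  let c : t → ℝ := fun i => if (i : X) ∈ U then 2 * |C| else δ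
  have hcsu : HasCompactSupport fun x => ∑ i, χ i x * c i := by
    refine HasCompactSupport.intro hK fun x hx => Finset.sum_eq_zero fun i _ => ?_
    rw [by_contra fun h => hx (hχW i x h).2, zero_mul]
  have hcu : Continuous fun x => ∑ i, χ i x * c i := by fun_prop
  refine ⟨fun x => ∑ i, (χ i x : ℂ) * φ i, fun x => ∑ i, χ i x * c i, by fun_prop, ?_, hcu,
    hcsu, fun x => ?_, ?_⟩
  · refine HasCompactSupport.intro hK fun x hx => Finset.sum_eq_zero fun i _ => ?_
    rw [by_contra fun h => hx (hχW i x h).2, Complex.ofReal_zero, zero_mul]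
  · refine norm_sub_weighted_sum_le (fun i => hχ0 i x)
      (fun h => hχL x (subset_tsupport _ h)) fun i hi => ?_
    have hW := (hχW i x hi).1
    by_cases hiU : (i : X) ∈ U
    · simp only [c, hiU, if_true]
      have h1 := norm_sub_le (φ x) (φ i)
      linarith [hC x, hC i, le_abs_self C]
    · simp only [hiU, if_false] at hW
      simp only [c, hiU, if_false]
      exact le_of_lt hW
  · have hle : ∀ x, ∑ i, χ i x * c i
        ≤ U.indicator (fun _ => 2 * |C|) x + K.indicator (fun _ => δ) x := by
      intro x
      have hterm : ∀ i, χ i x * c i ≤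
          χ i x * (U.indicator (fun _ => 2 * |C|) x + K.indicator (fun _ => δ) x) := by
        intro i
        by_cases h0 : χ i x = 0
        · simp [h0]
        refine mul_le_mul_of_nonneg_left ?_ (hχ0 i x)
        obtain ⟨hW, hxK⟩ := hχW i x h0
        by_cases hiU : (i : X) ∈ U
        · simp only [hiU, if_true] at hW
          simp [c, hiU, hW, hxK, hδ.le]
        · simp only [c, hiU, if_false, Set.indicator_of_mem hxK]
          exact le_add_of_nonneg_left (Set.indicator_nonneg (fun _ _ => by positivity) x)
      refine (Finset.sum_le_sum fun i _ => hterm i).trans ?_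
      rw [← Finset.sum_mul]
      exact mul_le_of_le_one_left (add_nonneg
        (Set.indicator_nonneg (fun _ _ => by positivity) x)
        (Set.indicator_nonneg (fun _ _ => hδ.le) x)) (hχ1 x)
    have hiU : Integrable (U.indicator fun _ => 2 * |C|) μ :=
      (integrable_indicator_iff hUo.measurableSet).2 (integrableOn_const hUfin)
    have hiK : Integrable (K.indicator fun _ => δ) μ :=
      (integrable_indicator_iff hK.measurableSet).2 (integrableOn_const hK.measure_ne_top)
    calc ∫ x, ∑ i, χ i x * c i ∂μ
        ≤ ∫ x, (U.indicator (fun _ => 2 * |C|) x + K.indicator (fun _ => δ) x) ∂μ :=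
          integral_mono (hcu.integrable_of_hasCompactSupport hcsu) (hiU.add hiK) hle
      _ = μ.real U * (2 * |C|) + μ.real K * δ := by
          rw [integral_add hiU hiK, integral_indicator_const _ hUo.measurableSet,
            integral_indicator_const _ hK.measurableSet, smul_eq_mul, smul_eq_mul]
      _ < ε := by
          have : μ.real U * (2 * |C|) ≤ 2 * |C| * η := by
            rw [mul_comm]
            exact mul_le_mul_of_nonneg_left hUη (by positivity)
          linarith

end Approximation

/-- **Approximation of Riemann integrable functions** (main approximation theorem).
Let `X`, `Y` be locally compact Hausdorff spaces, `p : X → Y` proper continuous, `μ` a positive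
Radon measure on `X`, `A` a dense `ℂ`-subalgebra of `C₀(Y)` and `M ⊆ C₀(X)` a `ℂ`-subspace of
`μ`-integrable functions, stable under multiplication by pullbacks of elements of `A`, stable
under complex conjugation, with dense restrictions to every fiber `p⁻¹(y)`, and such that every
element of `M` is dominated by a real-valued element of `M`.  Then every `μ`-Riemann integrable
function `φ` can be approximated: for every `ε > 0` there are `m₁, m₂ ∈ M` with `m₂` real-valued,
`|φ − m₁| ≤ m₂` pointwise and `∫ m₂ dμ < ε`. -/
theorem stmt1 {X Y : Type*}
    [TopologicalSpace X] [T2Space X] [LocallyCompactSpace X]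
    [TopologicalSpace Y] [T2Space Y] [LocallyCompactSpace Y]
    [MeasurableSpace X] [BorelSpace X]
    (p : X → Y) (hp : Continuous p)
    (hproper : ∀ K : Set Y, IsCompact K → IsCompact (p ⁻¹' K))
    (μ : Measure X) [μ.Regular]
    (A : NonUnitalSubalgebra ℂ C₀(Y, ℂ)) (hA : Dense (A : Set C₀(Y, ℂ)))
    (M : Submodule ℂ C₀(X, ℂ))
    (hint : ∀ m ∈ M, Integrable (fun x => m x) μ)
    (hmod : ∀ a ∈ A, ∀ m ∈ M, ∃ m' ∈ M, ∀ x, m' x = a (p x) * m x)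
    (hconj : ∀ m ∈ M, ∃ m' ∈ M, ∀ x, m' x = (starRingEnd ℂ) (m x))
    (hdense : ∀ y : Y, ∀ g : C(↥(p ⁻¹' ({y} : Set Y)), ℂ), ∀ ε > 0,
      ∃ m ∈ M, ∀ x : ↥(p ⁻¹' ({y} : Set Y)), ‖g x - m (x : X)‖ < ε)
    (hdom : ∀ m ∈ M, ∃ n ∈ M, (∀ x, (n x).im = 0) ∧ ∀ x, ‖m x‖ ≤ (n x).re)
    (φ : X → ℂ)
    (hbdd : ∃ C : ℝ, ∀ x, ‖φ x‖ ≤ C)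
    (hsupp : HasCompactSupport φ)
    (hnull : μ {x | ¬ ContinuousAt φ x} = 0) :
    ∀ ε > 0, ∃ m₁ ∈ M, ∃ m₂ ∈ M, (∀ x, ((m₂ : C₀(X, ℂ)) x).im = 0) ∧
      (∀ x, ‖φ x - (m₁ : C₀(X, ℂ)) x‖ ≤ ((m₂ : C₀(X, ℂ)) x).re) ∧
      ∫ x, ((m₂ : C₀(X, ℂ)) x).re ∂μ < ε := by
  intro ε hε
  have hcl : IsClosedMap p :=
    (isProperMap_iff_isCompact_preimage.2 ⟨hp, fun K hK => hproper K hK⟩).isClosedMap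
  obtain ⟨g, u, hg, hgc, hu, huc, hgu, hui⟩ :=
    exists_hasCompactSupport_norm_sub_le μ hbdd hsupp hnull (half_pos hε)
  have key := fun {f : X → ℂ} (hf : Continuous f) (hfc : HasCompactSupport f) =>
    exists_mem_norm_sub_le_of_hasCompactSupport hp hcl μ hA M hint hmod hdense hdom hf hfc
      (show 0 < ε / 6 by positivity)
  obtain ⟨m, hm, n, hn, him, hmn, hni⟩ := key hg hgc
  obtain ⟨m', hm', n', hn', him', hmn', hni'⟩ := key (f := fun x => (u x : ℂ)) (by fun_prop)
    (huc.comp_left Complex.ofReal_zero)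
  obtain ⟨r, hr, hrm⟩ := exists_mem_eq_re hconj hm'
  have hur : ∀ x, |u x - (r x).re| ≤ (n' x).re := fun x => by
    rw [hrm, Complex.ofReal_re]
    simpa using (Complex.abs_re_le_norm _).trans (hmn' x)
  have hre : ∀ {k : C₀(X, ℂ)}, k ∈ M → Integrable (fun x => (k x).re) μ :=
    fun {k} hk => (hint k hk).re
  have hiu := hu.integrable_of_hasCompactSupport (μ := μ) huc
  have hi₂ : Integrable (fun x => (n' x).re + (n' x).re) μ := (hre hn').add (hre hn')
  have hi₃ : Integrable (fun x => u x + ((n' x).re + (n' x).re)) μ := hiu.add hi₂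
  refine ⟨m, hm, r + n' + n, M.add_mem (M.add_mem hr hn') hn, fun x => ?_, fun x => ?_, ?_⟩
  · simp [hrm, him, him']
  · simp only [ZeroAtInftyContinuousMap.add_apply, Complex.add_re]
    have := norm_sub_le_norm_sub_add_norm_sub (φ x) (g x) (m x)
    linarith [hgu x, hmn x, (abs_le.1 (hur x)).2]
  · have hle : ∫ x, ((r + n' + n : C₀(X, ℂ)) x).re ∂μ
        ≤ ∫ x, (u x + ((n' x).re + (n' x).re) + (n x).re) ∂μ := by
      refine integral_mono (hre (M.add_mem (M.add_mem hr hn') hn))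
        (hi₃.add (hre hn)) fun x => ?_
      simp only [ZeroAtInftyContinuousMap.add_apply, Complex.add_re]
      linarith [(abs_le.1 (hur x)).1]
    have heq : ∫ x, (u x + ((n' x).re + (n' x).re) + (n x).re) ∂μ
        = ∫ x, u x ∂μ + (∫ x, (n' x).re ∂μ + ∫ x, (n' x).re ∂μ) + ∫ x, (n x).re ∂μ := by
      rw [integral_add hi₃ (hre hn), integral_add hiu hi₂, integral_add (hre hn') (hre hn')]
    linarith
end

section
/- Let μ be a measure on a measurable space X and let M be a set of μ-integrable real-valued functions on X. Let 0 < ε' < ε, let h be a μ-integrable function on X, and suppose there exists a μ-integrable function m' with |h| ≤ m' pointwise and ∫ m' dμ < ε', such that for every δ > 0 there exist n₁, n₂ ∈ M with |m'(x) − n₁(x)| ≤ n₂(x) for all x and ∫ n₂ dμ < δ. Then there exist n₁, n₂ ∈ M such that |h(x)| ≤ n₁(x) + n₂(x) for all x and ∫ (n₁ + n₂) dμ < ε. (Consequently, the linear topology on L¹(X, μ) whose basic neighborhoods of 0 are U_ε = {h : ∃ m ∈ M, |h| ≤ m and μ(m) < ε} is unchanged when M is replaced by its closure in this topology.) -/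
open MeasureTheory

/-- If `h` is dominated by `m'` with `∫ m' dμ < ε' < ε`, and `m'` can be approximated
arbitrarily well (in the sense of the topology `τ_M`) by elements of `M`, then `h` is
dominated by a sum `n₁ + n₂` of elements of `M` with `∫ (n₁ + n₂) dμ < ε`.
(This shows the topology `τ_M` is unchanged when `M` is replaced by its closure.) -/
theorem stmt2 {X : Type*} [MeasurableSpace X] (μ : Measure X)
    (M : Set (X → ℝ)) (hM : ∀ m ∈ M, Integrable m μ)
    (ε' ε : ℝ) (hε' : 0 < ε') (hε : ε' < ε)
    (h : X → ℝ) (hh : Integrable h μ)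
    (m' : X → ℝ) (hm' : Integrable m' μ)
    (hle : ∀ x, |h x| ≤ m' x) (hint : ∫ x, m' x ∂μ < ε')
    (happrox : ∀ δ > 0, ∃ n₁ ∈ M, ∃ n₂ ∈ M,
      (∀ x, |m' x - n₁ x| ≤ n₂ x) ∧ ∫ x, n₂ x ∂μ < δ) :
    ∃ n₁ ∈ M, ∃ n₂ ∈ M, (∀ x, |h x| ≤ n₁ x + n₂ x) ∧ ∫ x, (n₁ x + n₂ x) ∂μ < ε := by
  obtain ⟨n₁, hn₁, n₂, hn₂, hb, hd⟩ := happrox ((ε - ε') / 2) (by linarith)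
  refine ⟨n₁, hn₁, n₂, hn₂, fun x => ?_, ?_⟩
  · linarith [hle x, (abs_le.mp (hb x)).2]
  · have i₁ := hM n₁ hn₁
    have i₂ := hM n₂ hn₂
    have hmono : ∫ x, n₁ x ∂μ ≤ ∫ x, (m' x + n₂ x) ∂μ :=
      integral_mono i₁ (hm'.add i₂) fun x => by
        change n₁ x ≤ m' x + n₂ x
        linarith [(abs_le.mp (hb x)).1]
    rw [integral_add hm' i₂] at hmono
    rw [integral_add i₁ i₂]
    linarith
end

section
/- Let X be a topological space and let M be a ℂ-linear subspace of the space of continuous functions X → ℂ such that for every m ∈ M there exists a real-valued n ∈ M with |m(x)| ≤ n(x) for all x ∈ X. Let K ⊆ X be a compact set such that for every x ∈ K there exists m ∈ M with m(x) ≠ 0. Then there exists a real-valued function n ∈ M with n(x) ≥ 0 for all x ∈ X and n(x) ≥ 1 for all x ∈ K. -/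
/-- Let `M` be a `ℂ`-linear subspace of `C(X, ℂ)` such that every `m ∈ M` is dominated by a
real-valued element of `M`.  If `K` is compact and for every `x ∈ K` some element of `M` does
not vanish at `x`, then there is a real-valued `n ∈ M` with `n ≥ 0` on `X` and `n ≥ 1` on `K`. -/
theorem stmt15 {X : Type*} [TopologicalSpace X]
    (M : Submodule ℂ C(X, ℂ))
    (hdom : ∀ m ∈ M, ∃ n ∈ M, (∀ x, (n x).im = 0) ∧ ∀ x, ‖m x‖ ≤ (n x).re)
    (K : Set X) (hK : IsCompact K)
    (hnonvanish : ∀ x ∈ K, ∃ m ∈ M, m x ≠ 0) :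
    ∃ n ∈ M, (∀ x, (n x).im = 0) ∧ (∀ x, 0 ≤ (n x).re) ∧ ∀ x ∈ K, 1 ≤ (n x).re := by
  refine hK.induction_on ⟨0, M.zero_mem, by simp⟩ ?_ ?_ ?_
  · rintro s t hst ⟨n, hn, him, hpos, hone⟩
    exact ⟨n, hn, him, hpos, fun x hx => hone x (hst hx)⟩
  · rintro s t ⟨n, hn, him, hpos, hone⟩ ⟨n', hn', him', hpos', hone'⟩
    refine ⟨n + n', M.add_mem hn hn', fun x => by simp [him x, him' x],
      fun x => add_nonneg (hpos x) (hpos' x), ?_⟩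
    rintro x (hx | hx)
    · exact le_add_of_le_of_nonneg (hone x hx) (hpos' x)
    · exact le_add_of_nonneg_of_le (hpos x) (hone' x hx)
  · intro x hx
    obtain ⟨m, hm, hmx⟩ := hnonvanish x hx
    obtain ⟨n, hn, him, hle⟩ := hdom m hm
    have hpos : ∀ y, 0 ≤ (n y).re := fun y => (norm_nonneg _).trans (hle y)
    have hx0 : 0 < (n x).re := (norm_pos_iff.mpr hmx).trans_le (hle x)
    have hcont : Continuous fun y => (n y).re := Complex.continuous_re.comp n.continuous
    refine ⟨{y | (n x).re / 2 < (n y).re}, mem_nhdsWithin_of_mem_nhds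
      ((isOpen_lt continuous_const hcont).mem_nhds (half_lt_self hx0)),
      ((2 / (n x).re : ℝ) : ℂ) • n, M.smul_mem _ hn, fun y => ?_, fun y => ?_, fun y hy => ?_⟩
    · rw [ContinuousMap.smul_apply, smul_eq_mul, Complex.im_ofReal_mul, him y, mul_zero]
    · rw [ContinuousMap.smul_apply, smul_eq_mul, Complex.re_ofReal_mul]
      exact mul_nonneg (by positivity) (hpos y)
    · rw [ContinuousMap.smul_apply, smul_eq_mul, Complex.re_ofReal_mul, div_mul_eq_mul_div,
        one_le_div hx0]
      have hlt : (n x).re / 2 < (n y).re := hy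
      linarith
end
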